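/- (Structure of derivatives of the nonlinearity.) Let φ be smooth on a region U ⊂ {u ≤ u₀(M₀)} with |Zφ| ≤ δ̄^{1/2} u₊^{ζ(Z)} on U for every Z ∈ {Ω_{ij},∂_μ} (0 < δ̄ ≤ 1), let N^{αβ} be smooth functions with |d^iN^{αβ}/dy^i(φ)| ≤ C₀ for i ≤ 3 on U, and set F = N^{αβ}(φ)∂_αφ∂_βφ. Then there is a constant C (depending only on C₀) such that for n = 0,…,3, every ordered product Z^n of fields from {Ω_{ij},∂_μ}, and all indices α,β: (i) |Z^{(n)}(∂_αφ · ∂_βφ)| ≤ C Σ_{Z^a⊔Z^b⊔Z^c=Z^n} u₊^{ζ(Z^c)} |∂Z^{(b)}φ| · |∂Z^{(a)}φ| on U; (ii) |Z^{(n)}F| ≤ C ( ⁽ⁿ⁾F_Q + ⁽ⁿ⁾F_C ) on U, where ⁽ⁿ⁾F_Q = Σ_{Z^a⊔Z^b⊔Z^c=Z^n} u₊^{ζ(Z^c)} |∂Z^{(b)}φ||∂Z^{(a)}φ| and ⁽ⁿ⁾F_C = Σ_{Z^a⊔Z^b⊔Z^c⊔Z^d=Z^n, 1≤a≤n} |Z^{(a)}φ|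 |∂Z^{(b)}φ| |∂Z^{(c)}φ| u₊^{ζ(Z^d)}. -/

import Mathlib

open MeasureTheory Real Set

noncomputable section

namespace ExtStab

/-- Euclidean 3-space. -/
abbrev E3 := EuclideanSpace ℝ (Fin 3)
/-- Minkowski spacetime `ℝ^{1+3}`, as time × space. -/
abbrev Spt := ℝ × E3

/-- The spatial radius `r = |x|`. -/
def rr (p : Spt) : ℝ := ‖p.2‖

/-- The coordinate direction `∂_μ` as a vector. -/
def coordVec (μ : Fin 4) : Spt :=
  if _ : μ.1 = 0 then ((1 : ℝ), 0)
  else (0, EuclideanSpace.single ⟨μ.1 - 1, by have := μ.2; omega⟩ 1)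

/-- Spacetime coordinate functions `x^μ`. -/
def Xc (μ : Fin 4) (p : Spt) : ℝ :=
  if _ : μ.1 = 0 then p.1 else p.2 ⟨μ.1 - 1, by have := μ.2; omega⟩

/-- The Minkowski metric (and its inverse), signature `(-+++ )`. -/
def η (μ ν : Fin 4) : ℝ := if μ = ν then (if μ = 0 then -1 else 1) else 0

/-- coordinate derivative `∂_μ f`. -/
def pderiv (μ : Fin 4) (f : Spt → ℝ) (p : Spt) : ℝ := fderiv ℝ f p (coordVec μ)

/-- `∂_t f`. -/
def dt (f : Spt → ℝ) (p : Spt) : ℝ := fderiv ℝ f p (1, 0)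
/-- spatial coordinate derivative `∂_i f`. -/
def dx (i : Fin 3) (f : Spt → ℝ) (p : Spt) : ℝ := fderiv ℝ f p (0, EuclideanSpace.single i 1)
/-- radial derivative `∂_r f`. -/
def dr (f : Spt → ℝ) (p : Spt) : ℝ := fderiv ℝ f p (0, ‖p.2‖⁻¹ • p.2)
/-- `L = ∂_t + ∂_r`. -/
def Lop (f : Spt → ℝ) (p : Spt) : ℝ := fderiv ℝ f p (1, ‖p.2‖⁻¹ • p.2)
/-- `L̄ = ∂_t − ∂_r`. -/
def Lbop (f : Spt → ℝ) (p : Spt) : ℝ := fderiv ℝ f p (1, -(‖p.2‖⁻¹ • p.2))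
/-- angular derivative `∇_i = ∂_i − (x^i/r)∂_r`. -/
def slash (i : Fin 3) (f : Spt → ℝ) (p : Spt) : ℝ := dx i f p - (p.2 i / ‖p.2‖) * dr f p
/-- rotation `Ω_{ij} = x^i∂_j − x^j∂_i`. -/
def rot (i j : Fin 3) (f : Spt → ℝ) (p : Spt) : ℝ := p.2 i * dx j f p - p.2 j * dx i f p

/-- `|∇f|²`. -/
def gradSq (f : Spt → ℝ) (p : Spt) : ℝ := ∑ i, (slash i f p) ^ 2
/-- `|∂f|` (sum of absolute values of all coordinate derivatives). -/
def pdAbs (f : Spt → ℝ) (p : Spt) : ℝ := ∑ μ, |pderiv μ f p|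
/-- `|∂̲f| = |(L̄f, ∇f)|`. -/
def udAbs (f : Spt → ℝ) (p : Spt) : ℝ := |Lbop f p| + ∑ i, |slash i f p|
/-- `|∂f|²`. -/
def pdSq (f : Spt → ℝ) (p : Spt) : ℝ := ∑ μ, (pderiv μ f p) ^ 2

/-- the Minkowski wave operator `□_m = m^{μν}∂_μ∂_ν = −∂_t² + Δ`. -/
def boxm (f : Spt → ℝ) (p : Spt) : ℝ := ∑ μ, ∑ ν, η μ ν * pderiv μ (pderiv ν f) p

/-- the function `r·f`. -/
def rmul (f : Spt → ℝ) : Spt → ℝ := fun p => rr p * f p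

/-- `r_*(M₀,r) = r − 2M₀ log((r+M₀)/(1+M₀))`. -/
def rstar (M₀ r : ℝ) : ℝ := r - 2 * M₀ * Real.log ((r + M₀) / (1 + M₀))
/-- the optical function `u = t − r_*(M₀,r)`. -/
def uu (M₀ : ℝ) (p : Spt) : ℝ := p.1 - rstar M₀ ‖p.2‖
/-- the optical function `ū = t + r_*(M₀,r)`. -/
def ubar (M₀ : ℝ) (p : Spt) : ℝ := p.1 + rstar M₀ ‖p.2‖
/-- `u₀(M₀) = −r_*(M₀,R)`. -/
def u0 (M₀ R : ℝ) : ℝ := - rstar M₀ R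
/-- the inverse function of `r ↦ r_*(M₀,r)`. -/
def rOf (M₀ : ℝ) : ℝ → ℝ := Function.invFun (rstar M₀)
/-- the spacetime point with coordinates `(u, ū, ω)`. -/
def pt (M₀ uval vval : ℝ) (ω : E3) : Spt :=
  ((vval + uval) / 2, (rOf M₀ ((vval - uval) / 2)) • ω)

/-- the unit sphere in `E3`. -/
def sphere1 : Set E3 := Metric.sphere (0 : E3) 1

/-- integral over the unit sphere with the standard surface measure `dω`. -/
def sphI (g : E3 → ℝ) : ℝ := ∫ ω in sphere1, g ω ∂μH[2]

/-- integral over the truncated outgoing cone `H_u`, `ū' ∈ [lo, hi]`, measure `dū'dω`. -/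
def intH (M₀ uval lo hi : ℝ) (g : Spt → ℝ) : ℝ :=
  ∫ v in Icc lo hi, sphI (fun ω => g (pt M₀ uval v ω))

/-- integral over the truncated incoming cone `H̄_ū`, `u' ∈ [lo, hi]`, measure `du'dω`. -/
def intHb (M₀ vval lo hi : ℝ) (g : Spt → ℝ) : ℝ :=
  ∫ uval in Icc lo hi, sphI (fun ω => g (pt M₀ uval vval ω))

/-- integral over the sphere `S_{u,ū}` with the unit-sphere measure `dω`. -/
def sphS (M₀ uval vval : ℝ) (g : Spt → ℝ) : ℝ := sphI (fun ω => g (pt M₀ uval vval ω))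

/-- energy density on outgoing cones. -/
def eDH (M : ℝ) (q : E3 → ℝ) (f : Spt → ℝ) (p : Spt) : ℝ :=
  (1/2) * rr p ^ 2 *
    ((Lop f p) ^ 2 + (M / rr p) * (Lbop f p) ^ 2 + gradSq f p + q p.2 * (f p) ^ 2)

/-- energy density on incoming cones. -/
def eDHb (M : ℝ) (q : E3 → ℝ) (f : Spt → ℝ) (p : Spt) : ℝ :=
  (1/2) * rr p ^ 2 *
    ((Lbop f p) ^ 2 + (M / rr p) * (Lop f p) ^ 2 + gradSq f p + q p.2 * (f p) ^ 2)

/-- `E[f](H_u^ū)`. -/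
def energyH (M₀ M : ℝ) (q : E3 → ℝ) (f : Spt → ℝ) (uval vval : ℝ) : ℝ :=
  intH M₀ uval (-uval) vval (eDH M q f)

/-- `E[f](H̄_ū^u)`. -/
def energyHb (M₀ M : ℝ) (q : E3 → ℝ) (f : Spt → ℝ) (vval uval : ℝ) : ℝ :=
  intHb M₀ vval (-vval) uval (eDHb M q f)

/-- weighted energy density on outgoing cones. -/
def wDH (M : ℝ) (q : E3 → ℝ) (f : Spt → ℝ) (p : Spt) : ℝ :=
  (1/2) * (rr p * (Lop (rmul f) p) ^ 2 + M * rr p ^ 2 * (gradSq f p + q p.2 * (f p) ^ 2))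

/-- weighted energy density on incoming cones. -/
def wDHb (M : ℝ) (q : E3 → ℝ) (f : Spt → ℝ) (p : Spt) : ℝ :=
  (1/2) * (rr p ^ 3 * (gradSq f p + q p.2 * (f p) ^ 2) + M * rr p ^ 2 * (Lop f p) ^ 2)

/-- `W₁[f](H_u^ū)`. -/
def w1H (M₀ M : ℝ) (q : E3 → ℝ) (f : Spt → ℝ) (uval vval : ℝ) : ℝ :=
  intH M₀ uval (-uval) vval (wDH M q f)

/-- `W₁[f](H̄_ū^u)`. -/
def w1Hb (M₀ M : ℝ) (q : E3 → ℝ) (f : Spt → ℝ) (vval uval : ℝ) : ℝ :=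
  intHb M₀ vval (-vval) uval (wDHb M q f)

/-- the spacetime region `D_u^ū = {−ū ≤ −ū' ≤ u' ≤ u}`. -/
def Dreg (M₀ uval vval : ℝ) : Set Spt :=
  {p | -vval ≤ -ubar M₀ p ∧ -ubar M₀ p ≤ uu M₀ p ∧ uu M₀ p ≤ uval}

/-- `W₁[f](D_u^ū)` (spacetime measure). -/
def w1D (M₀ : ℝ) (f : Spt → ℝ) (uval vval : ℝ) : ℝ :=
  ∫ p in Dreg M₀ uval vval, (((rr p) ^ 2)⁻¹ * (Lop (rmul f) p) ^ 2 + gradSq f p)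

/-- the initial region `Σ₀^{u,ū} = {t = 0, −ū ≤ u' ≤ u}` (as a subset of `E3`). -/
def Sigma0 (M₀ uval vval : ℝ) : Set E3 :=
  {x | -vval ≤ -rstar M₀ ‖x‖ ∧ -rstar M₀ ‖x‖ ≤ uval}

/-- `E[f](Σ₀^{u,ū})`. -/
def energy0 (M₀ : ℝ) (q : E3 → ℝ) (f : Spt → ℝ) (uval vval : ℝ) : ℝ :=
  ∫ x in Sigma0 M₀ uval vval, (pdSq f (0, x) + q x * (f (0, x)) ^ 2)

/-- `W₁[f](Σ₀^{u,ū})`. -/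
def w10 (M₀ : ℝ) (q : E3 → ℝ) (f : Spt → ℝ) (uval vval : ℝ) : ℝ :=
  ∫ x in Sigma0 M₀ uval vval,
    (‖x‖⁻¹ * (Lop (rmul f) (0, x)) ^ 2 + ‖x‖ * (gradSq f (0, x) + q x * (f (0, x)) ^ 2))

/-- the commuting vector fields `Z ∈ {Ω_{ij}, ∂_μ}`. -/
inductive VF : Type
  | rot (i j : Fin 3) : VF
  | pd (μ : Fin 4) : VF
  deriving DecidableEq

/-- a vector field applied to a function. -/
def VF.app : VF → (Spt → ℝ) → Spt → ℝ
  | .rot i j, f => ExtStab.rot i j f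
  | .pd μ, f => pderiv μ f

/-- the signature `ζ(Z)`. -/
def VF.zeta : VF → ℤ
  | .rot _ _ => 0
  | .pd _ => -1

/-- the `n`-th order operator `Z^{(n)}` associated to an ordered product `Z^n = Z₁⋯Z_n`. -/
def Zop : List VF → (Spt → ℝ) → Spt → ℝ
  | [], f => f
  | Z :: l, f => Z.app (Zop l f)

/-- the signature `ζ(Z^n)` of a product. -/
def zeta (l : List VF) : ℤ := (l.map VF.zeta).sum

/-- all splittings `Z^a ⊔ Z^b = Z^n` of a product into two disjoint ordered subproducts. -/
def sp2 : List VF → List (List VF × List VF)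
  | [] => [([], [])]
  | z :: l => (sp2 l).map (fun p => (z :: p.1, p.2)) ++ (sp2 l).map (fun p => (p.1, z :: p.2))

/-- all splittings `Z^a ⊔ Z^b ⊔ Z^c = Z^n`. -/
def sp3 (l : List VF) : List (List VF × List VF × List VF) :=
  (sp2 l).flatMap (fun p => (sp2 p.2).map (fun q => (p.1, q.1, q.2)))

/-- all splittings `Z^a ⊔ Z^b ⊔ Z^c ⊔ Z^d = Z^n`. -/
def sp4 (l : List VF) : List (List VF × List VF × List VF × List VF) :=
  (sp2 l).flatMap (fun p => (sp3 p.2).map (fun q => (p.1, q)))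

/-- the index set of the rotation fields `Ω_{ij}`, `1 ≤ i < j ≤ 3`. -/
def rotIdx : Finset (Fin 3 × Fin 3) := Finset.univ.filter (fun ij => ij.1 < ij.2)

/-- `‖iteratedFDeriv‖` for data on `E3`. -/
def idfN (l : ℕ) (g : E3 → ℝ) (x : E3) : ℝ := ‖iteratedFDeriv ℝ l g x‖

/-- the weighted data norm `𝓔_{k,γ₀,R,q₀}` of an initial data set `(φ₀,φ₁)`. -/
def dataNorm (k : ℕ) (γ₀ R q₀ : ℝ) (φ₀ φ₁ : E3 → ℝ) : ℝ :=
  (∫ x in {x : E3 | R ≤ ‖x‖}, (1 + ‖x‖) ^ (γ₀ - 2) * (φ₀ x) ^ 2)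
  + ∑ l ∈ Finset.range (k + 1),
      ∫ x in {x : E3 | R ≤ ‖x‖},
        (1 + ‖x‖) ^ (γ₀ + 2 * (l : ℝ)) *
          ((idfN (l + 1) φ₀ x) ^ 2 + (idfN l φ₁ x) ^ 2 + q₀ * (idfN l φ₀ x) ^ 2)

/-- finiteness (integrability) of the weighted data norm. -/
def DataFinite (k : ℕ) (γ₀ R q₀ : ℝ) (φ₀ φ₁ : E3 → ℝ) : Prop :=
  IntegrableOn (fun x : E3 => (1 + ‖x‖) ^ (γ₀ - 2) * (φ₀ x) ^ 2) {x : E3 | R ≤ ‖x‖} ∧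
  ∀ l ≤ k, IntegrableOn
    (fun x : E3 => (1 + ‖x‖) ^ (γ₀ + 2 * (l : ℝ)) *
      ((idfN (l + 1) φ₀ x) ^ 2 + (idfN l φ₁ x) ^ 2 + q₀ * (idfN l φ₀ x) ^ 2))
    {x : E3 | R ≤ ‖x‖}

/-- `‖iteratedFDeriv‖` for spacetime functions. -/
def idfNST (l : ℕ) (g : Spt → ℝ) (p : Spt) : ℝ := ‖iteratedFDeriv ℝ l g p‖

/-- the weighted data norm of `φ[0]`, with all spacetime derivatives at `t = 0`. -/
def dataNormST (k : ℕ) (γ₀ R q₀ : ℝ) (φ : Spt → ℝ) : ℝ :=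
  (∫ x in {x : E3 | R ≤ ‖x‖}, (1 + ‖x‖) ^ (γ₀ - 2) * (φ (0, x)) ^ 2)
  + ∑ l ∈ Finset.range (k + 1),
      ∫ x in {x : E3 | R ≤ ‖x‖},
        (1 + ‖x‖) ^ (γ₀ + 2 * (l : ℝ)) *
          ((idfNST (l + 1) φ (0, x)) ^ 2 + q₀ * (idfNST l φ (0, x)) ^ 2)

/-- finiteness (integrability) of the spacetime weighted data norm. -/
def DataFiniteST (k : ℕ) (γ₀ R q₀ : ℝ) (φ : Spt → ℝ) : Prop :=
  IntegrableOn (fun x : E3 => (1 + ‖x‖) ^ (γ₀ - 2) * (φ (0, x)) ^ 2) {x : E3 | R ≤ ‖x‖} ∧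
  ∀ l ≤ k, IntegrableOn
    (fun x : E3 => (1 + ‖x‖) ^ (γ₀ + 2 * (l : ℝ)) *
      ((idfNST (l + 1) φ (0, x)) ^ 2 + q₀ * (idfNST l φ (0, x)) ^ 2))
    {x : E3 | R ≤ ‖x‖}

/-- the potential assumption: `q : ℝ³ → [0,1]` smooth with `|r^i ∂^{(i)}q| ≲ r^{−2−η}`, `1 ≤ i ≤ n`. -/
def PotAssum (n : ℕ) (q : E3 → ℝ) : Prop :=
  ContDiff ℝ (⊤ : ℕ∞) q ∧ (∀ x, 0 ≤ q x ∧ q x ≤ 1) ∧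
  ∃ ηc > (0 : ℝ), ∃ C > (0 : ℝ), ∀ i : ℕ, 1 ≤ i → i ≤ n → ∀ x : E3, x ≠ 0 →
    ‖x‖ ^ (i : ℝ) * ‖iteratedFDeriv ℝ i q x‖ ≤ C * ‖x‖ ^ (-(2 : ℝ) - ηc)

/-- the bootstrap assumption `(BA_n)` on the region `{−ū_* ≤ −ū ≤ u ≤ u₀(M₀,R)}`. -/
def BA (M₀ M : ℝ) (q : E3 → ℝ) (γ₀ δ ubst R : ℝ) (n : ℕ) (φ : Spt → ℝ) : Prop :=
  ∀ Zl : List VF, Zl.length ≤ n → ∀ uval vval : ℝ,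
    -ubst ≤ -vval → -vval ≤ uval → uval ≤ u0 M₀ R →
      (energyH M₀ M q (Zop Zl φ) uval vval + energyHb M₀ M q (Zop Zl φ) vval uval
        ≤ 2 * δ * (-uval) ^ (-γ₀ + 2 * (zeta Zl : ℝ))) ∧
      (w1H M₀ M q (Zop Zl φ) uval vval + w1Hb M₀ M q (Zop Zl φ) vval uval
          + w1D M₀ (Zop Zl φ) uval vval
        ≤ 2 * δ * (-uval) ^ (-γ₀ + 1 + 2 * (zeta Zl : ℝ)))

/-- `∫_ω |F|² dω` on `S_{u,ū}`. -/
def sphL2 (M₀ : ℝ) (F : Spt → ℝ) (uval vval : ℝ) : ℝ := sphS M₀ uval vval (fun p => (F p) ^ 2)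
/-- `∫_ω |F|⁴ dω` on `S_{u,ū}`. -/
def sphL4 (M₀ : ℝ) (F : Spt → ℝ) (uval vval : ℝ) : ℝ := sphS M₀ uval vval (fun p => (F p) ^ 4)

/-- `‖F‖_{L²(D_{u₁}^{ū₁})}` (spacetime measure). -/
def nL2D (M₀ : ℝ) (F : Spt → ℝ) (u1 v1 : ℝ) : ℝ :=
  Real.sqrt (∫ p in Dreg M₀ u1 v1, (F p) ^ 2)
/-- `‖F‖_{L¹_ū L²_u L²_ω(D_{u₁}^{ū₁})}`. -/
def nL1ubL2uL2o (M₀ : ℝ) (F : Spt → ℝ) (u1 v1 : ℝ) : ℝ :=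
  ∫ v in Icc (-u1) v1, Real.sqrt (∫ uval in Icc (-v) u1, sphL2 M₀ F uval v)
/-- `‖F‖_{L¹_u L²_ū L²_ω(D_{u₁}^{ū₁})}`. -/
def nL1uL2ubL2o (M₀ : ℝ) (F : Spt → ℝ) (u1 v1 : ℝ) : ℝ :=
  ∫ uval in Icc (-v1) u1, Real.sqrt (∫ v in Icc (-uval) v1, sphL2 M₀ F uval v)
/-- `‖F‖_{L²_u L⁴_ω(H̄_{ū₁}^{u₁})}`. -/
def nL2uL4oHb (M₀ : ℝ) (F : Spt → ℝ) (v1 u1 : ℝ) : ℝ :=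
  Real.sqrt (∫ uval in Icc (-v1) u1, Real.sqrt (sphL4 M₀ F uval v1))
/-- `‖F‖_{L²_u L²_ū L⁴_ω(D_{u₁}^{ū₁})}`. -/
def nL2uL2ubL4o (M₀ : ℝ) (F : Spt → ℝ) (u1 v1 : ℝ) : ℝ :=
  Real.sqrt (∫ uval in Icc (-v1) u1, ∫ v in Icc (-uval) v1, Real.sqrt (sphL4 M₀ F uval v))
/-- `‖F‖_{L²_ū L²_u L⁴_ω(D_{u₁}^{ū₁})}`. -/
def nL2ubL2uL4o (M₀ : ℝ) (F : Spt → ℝ) (u1 v1 : ℝ) : ℝ :=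
  Real.sqrt (∫ v in Icc (-u1) v1, ∫ uval in Icc (-v) u1, Real.sqrt (sphL4 M₀ F uval v))
/-- `‖F‖_{L^∞_ū L²_u L⁴_ω(D_{u₁}^{ū₁})}`. -/
def nLinfubL2uL4o (M₀ : ℝ) (F : Spt → ℝ) (u1 v1 : ℝ) : ℝ :=
  ⨆ v ∈ Icc (-u1) v1, Real.sqrt (∫ uval in Icc (-v) u1, Real.sqrt (sphL4 M₀ F uval v))
/-- `‖F‖_{L²_u L^∞_ū L⁴_ω(D_{u₁}^{ū₁})}`. -/
def nL2uLinfubL4o (M₀ : ℝ) (F : Spt → ℝ) (u1 v1 : ℝ) : ℝ :=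
  Real.sqrt (∫ uval in Icc (-v1) u1,
    (⨆ v ∈ Icc (-uval) v1, (sphL4 M₀ F uval v) ^ ((4 : ℝ)⁻¹)) ^ 2)
/-- `‖F‖_{L²_ū L^∞_u L⁴_ω(D_{u₁}^{ū₁})}`. -/
def nL2ubLinfuL4o (M₀ : ℝ) (F : Spt → ℝ) (u1 v1 : ℝ) : ℝ :=
  Real.sqrt (∫ v in Icc (-u1) v1,
    (⨆ uval ∈ Icc (-v) u1, (sphL4 M₀ F uval v) ^ ((4 : ℝ)⁻¹)) ^ 2)
/-- `‖F‖_{L²_ū L^∞(D_{u₁}^{ū₁})}`. -/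
def nL2ubLinf (M₀ : ℝ) (F : Spt → ℝ) (u1 v1 : ℝ) : ℝ :=
  Real.sqrt (∫ v in Icc (-u1) v1,
    (⨆ uval ∈ Icc (-v) u1, ⨆ ω ∈ sphere1, |F (pt M₀ uval v ω)|) ^ 2)
/-- `‖F‖_{L⁴_ω(S_{u,ū})}`. -/
def nL4oS (M₀ : ℝ) (F : Spt → ℝ) (uval vval : ℝ) : ℝ := (sphL4 M₀ F uval vval) ^ ((4 : ℝ)⁻¹)

/-- `E[Ω^{(≤1)}ψ](H_u^ū)`. -/
def energyHrot1 (M₀ M : ℝ) (q : E3 → ℝ) (f : Spt → ℝ) (uval vval : ℝ) : ℝ :=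
  energyH M₀ M q f uval vval + ∑ ij ∈ rotIdx, energyH M₀ M q (rot ij.1 ij.2 f) uval vval

/-- `E[Ω^{(≤1)}ψ](H̄_ū^u)`. -/
def energyHbrot1 (M₀ M : ℝ) (q : E3 → ℝ) (f : Spt → ℝ) (vval uval : ℝ) : ℝ :=
  energyHb M₀ M q f vval uval + ∑ ij ∈ rotIdx, energyHb M₀ M q (rot ij.1 ij.2 f) vval uval

/-- `L′ = L − hL̄`. -/
def Lp (M₀ : ℝ) (f : Spt → ℝ) (p : Spt) : ℝ := Lop f p - (M₀ / rr p) * Lbop f p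
/-- `L̄′ = L̄ − hL`. -/
def Lbp (M₀ : ℝ) (f : Spt → ℝ) (p : Spt) : ℝ := Lbop f p - (M₀ / rr p) * Lop f p

/-- `r^γ · f` (real power weight). -/
def rpw (γ : ℝ) (f : Spt → ℝ) : Spt → ℝ := fun p => rr p ^ γ * f p


/-- `q₀ = sup_{|x| ≥ R} q`. -/
def qsup (R : ℝ) (q : E3 → ℝ) : ℝ := sSup (q '' {x : E3 | R ≤ ‖x‖})

/-- the quadratic majorant `⁽ⁿ⁾F_Q = Σ_{Z^a⊔Z^b⊔Z^c=Z^n} u₊^{ζ(Z^c)}|∂Z^{(b)}φ||∂Z^{(a)}φ|`. -/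
def FQ (M₀ : ℝ) (φ : Spt → ℝ) (Zl : List VF) (p : Spt) : ℝ :=
  ((sp3 Zl).map (fun abc =>
    (-(uu M₀ p)) ^ (zeta abc.2.2) * pdAbs (Zop abc.2.1 φ) p * pdAbs (Zop abc.1 φ) p)).sum

/-- the cubic majorant
`⁽ⁿ⁾F_C = Σ_{Z^a⊔Z^b⊔Z^c⊔Z^d=Z^n, a≥1} |Z^{(a)}φ||∂Z^{(b)}φ||∂Z^{(c)}φ| u₊^{ζ(Z^d)}`. -/
def FC (M₀ : ℝ) (φ : Spt → ℝ) (Zl : List VF) (p : Spt) : ℝ :=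
  ((sp4 Zl).map (fun x =>
    if x.1 = [] then 0
    else |Zop x.1 φ p| * pdAbs (Zop x.2.1 φ) p * pdAbs (Zop x.2.2.1 φ) p
          * (-(uu M₀ p)) ^ (zeta x.2.2.2))).sum

/-- smooth functions. -/
def Sm (f : Spt → ℝ) : Prop := ContDiff ℝ (⊤ : ℕ∞) f

/-- The vector of a vector field at a point. -/
def VF.vec : VF → Spt → Spt
  | .rot i j, p => p.2 i • coordVec j.succ - p.2 j • coordVec i.succ
  | .pd μ, _ => coordVec μ

lemma coordVec_succ (j : Fin 3) : coordVec j.succ = (0, EuclideanSpace.single j 1) := by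
  simp [coordVec]

lemma app_eq (Z : VF) (f : Spt → ℝ) (p : Spt) : Z.app f p = fderiv ℝ f p (Z.vec p) := by
  cases Z with
  | rot i j =>
    simp only [VF.app, VF.vec, rot, dx, coordVec_succ, map_sub, map_smul, smul_eq_mul]
  | pd μ => simp [VF.app, VF.vec, pderiv]

lemma vec_smooth (Z : VF) : ContDiff ℝ (⊤ : ℕ∞) Z.vec := by
  cases Z with
  | rot i j =>
    have h : ∀ k : Fin 3, ContDiff ℝ (⊤ : ℕ∞) (fun p : Spt => p.2 k) := by
      intro k
      fun_prop
    exact ((h i).smul contDiff_const).sub ((h j).smul contDiff_const)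
  | pd μ => exact contDiff_const

lemma Sm.fd {f : Spt → ℝ} (hf : Sm f) : ContDiff ℝ (⊤ : ℕ∞) (fderiv ℝ f) :=
  ContDiff.fderiv_right hf (by norm_num)

lemma Sm.app {f : Spt → ℝ} (hf : Sm f) (Z : VF) : Sm (Z.app f) := by
  have : Z.app f = fun p => fderiv ℝ f p (Z.vec p) := funext (app_eq Z f)
  rw [this]
  exact hf.fd.clm_apply (vec_smooth Z)

lemma Sm.pd {f : Spt → ℝ} (hf : Sm f) (μ : Fin 4) : Sm (pderiv μ f) := hf.app (.pd μ)

lemma Sm.zop {f : Spt → ℝ} (hf : Sm f) (l : List VF) : Sm (Zop l f) := by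
  induction l with
  | nil => exact hf
  | cons z l ih => exact ih.app z

lemma Sm.da {f : Spt → ℝ} (hf : Sm f) (p : Spt) : DifferentiableAt ℝ f p :=
  (ContDiff.differentiable hf (by norm_num)) p

lemma app_mul {f g : Spt → ℝ} (hf : Sm f) (hg : Sm g) (Z : VF) (p : Spt) :
    Z.app (fun x => f x * g x) p = Z.app f p * g p + f p * Z.app g p := by
  simp only [app_eq]
  rw [fderiv_fun_mul (hf.da p) (hg.da p)]
  simp; ring

lemma app_add {f g : Spt → ℝ} (hf : Sm f) (hg : Sm g) (Z : VF) (p : Spt) :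
    Z.app (fun x => f x + g x) p = Z.app f p + Z.app g p := by
  simp only [app_eq]
  rw [fderiv_fun_add (hf.da p) (hg.da p)]
  simp

lemma app_cmul {f : Spt → ℝ} (hf : Sm f) (c : ℝ) (Z : VF) (p : Spt) :
    Z.app (fun x => c * f x) p = c * Z.app f p := by
  simp only [app_eq]
  rw [fderiv_const_mul (hf.da p)]
  simp

lemma app_zero (Z : VF) (p : Spt) : Z.app (fun _ => 0) p = 0 := by
  simp [app_eq]

lemma Sm.lsum {X : Type*} (L : List X) (f : X → Spt → ℝ) (h : ∀ x ∈ L, Sm (f x)) :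
    Sm (fun p => (L.map (fun x => f x p)).sum) := by
  induction L with
  | nil => exact contDiff_const
  | cons a L ih =>
    simp only [List.map_cons, List.sum_cons]
    exact ContDiff.add (h a (by simp)) (ih (fun x hx => h x (by simp [hx])))

lemma app_lsum {X : Type*} (L : List X) (f : X → Spt → ℝ) (h : ∀ x ∈ L, Sm (f x)) (Z : VF)
    (p : Spt) :
    Z.app (fun p => (L.map (fun x => f x p)).sum) p = (L.map (fun x => Z.app (f x) p)).sum := by
  induction L with
  | nil => simpa using app_zero Z p
  | cons a L ih =>
    simp only [List.map_cons, List.sum_cons]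
    rw [app_add (h a (by simp)) (Sm.lsum L f (fun x hx => h x (by simp [hx]))),
      ih (fun x hx => h x (by simp [hx]))]

lemma zop_mul {f g : Spt → ℝ} (hf : Sm f) (hg : Sm g) (l : List VF) :
    Zop l (fun x => f x * g x) =
      fun p => ((sp2 l).map (fun ab => Zop ab.1 f p * Zop ab.2 g p)).sum := by
  induction l with
  | nil => simp [Zop, sp2]
  | cons z l ih =>
    funext p
    simp only [Zop, ih]
    rw [app_lsum (sp2 l) (fun ab p => Zop ab.1 f p * Zop ab.2 g p)
      (fun x _ => ContDiff.mul (hf.zop _) (hg.zop _))]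
    simp only [sp2, List.map_append, List.map_map, List.sum_append]
    rw [← List.sum_map_add]
    congr 1
    apply List.map_congr_left
    intro ab _
    rw [app_mul (hf.zop _) (hg.zop _)]
    simp [Zop]

lemma zop_lsum {X : Type*} (L : List X) (f : X → Spt → ℝ) (h : ∀ x ∈ L, Sm (f x)) (l : List VF) :
    Zop l (fun p => (L.map (fun x => f x p)).sum) = fun p => (L.map (fun x => Zop l (f x) p)).sum := by
  induction l with
  | nil => rfl
  | cons z l ih =>
    funext p
    simp only [Zop, ih]
    exact app_lsum L (fun x => Zop l (f x)) (fun x hx => (h x hx).zop l) z p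

/-! commutators -/

lemma fderiv_app {f : Spt → ℝ} (hf : Sm f) (Z : VF) (p v : Spt) :
    fderiv ℝ (Z.app f) p v = fderiv ℝ (fderiv ℝ f) p v (Z.vec p)
      + fderiv ℝ f p (fderiv ℝ Z.vec p v) := by
  have : Z.app f = fun p => fderiv ℝ f p (Z.vec p) := funext (app_eq Z f)
  rw [this, fderiv_clm_apply (hf.fd.differentiable (by norm_num) p)
    ((vec_smooth Z).differentiable (by norm_num) p)]
  simp [add_comm]

lemma fderiv2_symm {f : Spt → ℝ} (hf : Sm f) (p v w : Spt) :
    fderiv ℝ (fderiv ℝ f) p v w = fderiv ℝ (fderiv ℝ f) p w v := by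
  have h : IsSymmSndFDerivAt ℝ f p :=
    (ContDiff.contDiffAt hf).isSymmSndFDerivAt (by
      simp only [minSmoothness_of_isRCLikeNormedField]
      exact WithTop.coe_le_coe.2 (le_top : (2 : ℕ∞) ≤ ⊤))
  exact h v w

lemma fderiv_vec_pd (μ : Fin 4) (p v : Spt) : fderiv ℝ (VF.vec (.pd μ)) p v = 0 := by
  have : VF.vec (.pd μ) = fun _ => coordVec μ := rfl
  simp [this]

lemma fderiv_vec_rot (i j : Fin 3) (p v : Spt) : fderiv ℝ (VF.vec (.rot i j)) p v =
    v.2 i • coordVec j.succ - v.2 j • coordVec i.succ := by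
  let P : Fin 3 → Spt →L[ℝ] ℝ := fun k =>
    (EuclideanSpace.proj k : E3 →L[ℝ] ℝ).comp (ContinuousLinearMap.snd ℝ ℝ E3)
  let A : Spt →L[ℝ] Spt := (P i).smulRight (coordVec j.succ) - (P j).smulRight (coordVec i.succ)
  have : VF.vec (.rot i j) = A := by
    funext p; rfl
  rw [this, ContinuousLinearMap.fderiv]
  rfl

lemma comm_eq {f : Spt → ℝ} (hf : Sm f) (Z : VF) (μ : Fin 4) (p : Spt) :
    Z.app (pderiv μ f) p = pderiv μ (Z.app f) p
      - fderiv ℝ f p (fderiv ℝ Z.vec p (coordVec μ)) := by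
  have h1 : pderiv μ f = VF.app (.pd μ) f := rfl
  have h2 : pderiv μ (Z.app f) p = fderiv ℝ (Z.app f) p (coordVec μ) := rfl
  rw [app_eq, h1, h2, fderiv_app hf, fderiv_app hf, fderiv_vec_pd, fderiv2_symm hf]
  simp [VF.vec]

/-! splittings -/

lemma sp2_swap {l a b : List VF} (h : (a, b) ∈ sp2 l) : (b, a) ∈ sp2 l := by
  induction l generalizing a b with
  | nil => simp_all [sp2]
  | cons z l ih =>
    simp only [sp2, List.mem_append, List.mem_map, Prod.mk.injEq, Prod.exists] at h ⊢
    rcases h with ⟨x, y, h, rfl, rfl⟩ | ⟨x, y, h, rfl, rfl⟩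
    · exact Or.inr ⟨_, _, ih h, rfl, rfl⟩
    · exact Or.inl ⟨_, _, ih h, rfl, rfl⟩

lemma sp2_cons_left {l a b : List VF} (z : VF) (h : (a, b) ∈ sp2 l) : (z :: a, b) ∈ sp2 (z :: l) := by
  simp [sp2, h]

lemma sp2_cons_right {l a b : List VF} (z : VF) (h : (a, b) ∈ sp2 l) :
    (a, z :: b) ∈ sp2 (z :: l) := by
  simp [sp2, h]

lemma sp2_cases {z : VF} {l a b : List VF} (h : (a, b) ∈ sp2 (z :: l)) :
    (∃ a', a = z :: a' ∧ (a', b) ∈ sp2 l) ∨ (∃ b', b = z :: b' ∧ (a, b') ∈ sp2 l) := by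
  simp only [sp2, List.mem_append, List.mem_map, Prod.mk.injEq, Prod.exists] at h
  rcases h with ⟨x, y, h, rfl, rfl⟩ | ⟨x, y, h, rfl, rfl⟩
  · exact Or.inl ⟨_, rfl, h⟩
  · exact Or.inr ⟨_, rfl, h⟩

lemma sp2_nil_eq {l b : List VF} (h : ([], b) ∈ sp2 l) : b = l := by
  induction l generalizing b with
  | nil => simpa [sp2] using h
  | cons z l ih =>
    replace h := sp2_cases h
    rcases h with ⟨_, h, _⟩ | ⟨b', rfl, h⟩
    · simp at h
    · rw [ih h]

lemma sp2_len {l a b : List VF} (h : (a, b) ∈ sp2 l) : l.length = a.length + b.length := by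
  induction l generalizing a b with
  | nil => simp_all [sp2]
  | cons z l ih =>
    replace h := sp2_cases h
    rcases h with ⟨_, rfl, h⟩ | ⟨b', rfl, h⟩ <;> simp [ih h] <;> omega

lemma sp2_zeta {l a b : List VF} (h : (a, b) ∈ sp2 l) : zeta l = zeta a + zeta b := by
  induction l generalizing a b with
  | nil => simp_all [sp2, zeta]
  | cons z l ih =>
    replace h := sp2_cases h
    rcases h with ⟨_, rfl, h⟩ | ⟨b', rfl, h⟩ <;>
      (have := ih h; simp [zeta] at this ⊢; omega)

lemma sp2_assoc {l a b a1 a2 : List VF} (h : (a, b) ∈ sp2 l) (h' : (a1, a2) ∈ sp2 a) :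
    ∃ m, (a1, m) ∈ sp2 l ∧ (a2, b) ∈ sp2 m := by
  induction l generalizing a b a1 a2 with
  | nil =>
    obtain ⟨rfl, rfl⟩ : a = [] ∧ b = [] := by simpa [sp2] using h
    obtain ⟨rfl, rfl⟩ : a1 = [] ∧ a2 = [] := by simpa [sp2] using h'
    exact ⟨[], h, h⟩
  | cons z l ih =>
    replace h := sp2_cases h
    rcases h with ⟨_, rfl, h⟩ | ⟨b', rfl, h⟩
    · replace h' := sp2_cases h'
      rcases h' with ⟨_, rfl, h'⟩ | ⟨b', rfl, h'⟩
      · obtain ⟨m, h1, h2⟩ := ih h h'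
        exact ⟨m, sp2_cons_left z h1, h2⟩
      · obtain ⟨m, h1, h2⟩ := ih h h'
        exact ⟨z :: m, sp2_cons_right z h1, sp2_cons_left z h2⟩
    · obtain ⟨m, h1, h2⟩ := ih h h'
      exact ⟨z :: m, sp2_cons_right z h1, sp2_cons_right z h2⟩

lemma sp3_mem {l a b c q : List VF} (h : (a, q) ∈ sp2 l) (h' : (b, c) ∈ sp2 q) :
    (a, b, c) ∈ sp3 l := by
  simp only [sp3, List.mem_flatMap, List.mem_map]
  exact ⟨_, h, _, h', rfl⟩

lemma mem_sp3 {l a b c : List VF} (h : (a, b, c) ∈ sp3 l) :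
    ∃ q, (a, q) ∈ sp2 l ∧ (b, c) ∈ sp2 q := by
  simp only [sp3, List.mem_flatMap, List.mem_map] at h
  obtain ⟨⟨x, y⟩, h, ⟨z, w⟩, h', e⟩ := h
  simp only [Prod.mk.injEq] at e
  obtain ⟨rfl, rfl, rfl⟩ := e
  exact ⟨_, h, h'⟩

lemma sp4_mem {l a b c d m q : List VF} (h0 : (a, m) ∈ sp2 l) (h : (b, q) ∈ sp2 m)
    (h' : (c, d) ∈ sp2 q) : (a, b, c, d) ∈ sp4 l := by
  simp only [sp4, List.mem_flatMap, List.mem_map]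
  exact ⟨_, h0, _, sp3_mem h h', rfl⟩

/-- Representation of `Z^{(l)} ∂_α φ`. -/
lemma rep (l : List VF) (α : Fin 4) : ∃ K : List (ℝ × Fin 4 × List VF),
    (∀ t ∈ K, ∃ c, (t.2.2, c) ∈ sp2 l ∧ zeta c = 0) ∧
    ∀ φ : Spt → ℝ, Sm φ → Zop l (pderiv α φ) =
      fun p => (K.map (fun t => t.1 * pderiv t.2.1 (Zop t.2.2 φ) p)).sum := by
  induction l with
  | nil =>
    refine ⟨[(1, α, [])], ?_, ?_⟩
    · intro t ht
      obtain rfl : t = (1, α, []) := by simpa using ht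
      exact ⟨[], by simp [sp2], by simp [zeta]⟩
    · intro φ _
      simp [Zop]
  | cons z l ih =>
    obtain ⟨K, hK, hrep⟩ := ih
    cases z with
    | pd μ =>
      refine ⟨K.map (fun t => (t.1, t.2.1, .pd μ :: t.2.2)), ?_, ?_⟩
      · intro t ht
        obtain ⟨s, hs, rfl⟩ := List.mem_map.1 ht
        obtain ⟨c, h1, h2⟩ := hK s hs
        exact ⟨c, sp2_cons_left _ h1, h2⟩
      · intro φ hφ
        funext p
        simp only [Zop, hrep φ hφ]
        rw [app_lsum K (fun t p => t.1 * pderiv t.2.1 (Zop t.2.2 φ) p)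
          (fun t _ => ContDiff.mul contDiff_const ((hφ.zop _).pd _)), List.map_map]
        congr 1
        apply List.map_congr_left
        intro t _
        rw [app_cmul ((hφ.zop _).pd _), comm_eq (hφ.zop _), fderiv_vec_pd]
        simp [Zop]
    | rot i j =>
      refine ⟨K.map (fun t => (t.1, t.2.1, .rot i j :: t.2.2)) ++
        (K.map (fun t => (-t.1 * (coordVec t.2.1).2 i, j.succ, t.2.2)) ++
        K.map (fun t => (t.1 * (coordVec t.2.1).2 j, i.succ, t.2.2))), ?_, ?_⟩
      · intro t ht
        simp only [List.mem_append, List.mem_map] at ht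
        rcases ht with ⟨s, hs, rfl⟩ | ⟨s, hs, rfl⟩ | ⟨s, hs, rfl⟩ <;>
          obtain ⟨c, h1, h2⟩ := hK s hs
        · exact ⟨c, sp2_cons_left _ h1, h2⟩
        · exact ⟨_, sp2_cons_right (.rot i j) h1, by simpa [zeta, VF.zeta] using h2⟩
        · exact ⟨_, sp2_cons_right (.rot i j) h1, by simpa [zeta, VF.zeta] using h2⟩
      · intro φ hφ
        funext p
        simp only [Zop, hrep φ hφ]
        rw [app_lsum K (fun t p => t.1 * pderiv t.2.1 (Zop t.2.2 φ) p)
          (fun t _ => ContDiff.mul contDiff_const ((hφ.zop _).pd _))]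
        simp only [List.map_append, List.sum_append, List.map_map]
        rw [← List.sum_map_add, ← List.sum_map_add]
        congr 1
        apply List.map_congr_left
        intro t _
        rw [app_cmul ((hφ.zop _).pd _), comm_eq (hφ.zop _), fderiv_vec_rot]
        simp only [Function.comp, Zop, map_sub, map_smul, smul_eq_mul, pderiv]
        ring

/-- all the pointwise data. -/
structure Dat (C₀ : ℝ) where
  N : Fin 4 → Fin 4 → ℝ → ℝ
  φ : Spt → ℝ
  M₀ : ℝ
  p : Spt
  hφ : Sm φ
  hN : ∀ α β, ContDiff ℝ (⊤ : ℕ∞) (N α β)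
  hu : 0 < -(uu M₀ p)
  hZ : ∀ Z : VF, |Z.app φ p| ≤ (-(uu M₀ p)) ^ (VF.zeta Z)
  hb : ∀ α β, ∀ i : ℕ, i ≤ 3 → |iteratedDeriv i (N α β) (φ p)| ≤ C₀

/-- uniform domination. -/
def Dom {D : Type} (f B : D → ℝ) : Prop := ∃ C : ℝ, 0 ≤ C ∧ ∀ d, |f d| ≤ C * B d

lemma Dom.lsum {D : Type} {X : Type*} (L : List X) (f : X → D → ℝ) (B : D → ℝ)
    (h : ∀ x ∈ L, Dom (f x) B) : Dom (fun d => (L.map (fun x => f x d)).sum) B := by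
  induction L with
  | nil => exact ⟨0, le_rfl, by simp⟩
  | cons a L ih =>
    obtain ⟨C1, h1, h1'⟩ := h a (by simp)
    obtain ⟨C2, h2, h2'⟩ := ih (fun x hx => h x (by simp [hx]))
    refine ⟨C1 + C2, by positivity, fun d => ?_⟩
    simp only [List.map_cons, List.sum_cons]
    rw [add_mul]
    exact (abs_add_le _ _).trans (add_le_add (h1' d) (h2' d))

lemma Dom.mul {D : Type} {f g A B : D → ℝ} (h : Dom f A) (h' : Dom g B) :
    Dom (fun d => f d * g d) (fun d => A d * B d) := by
  obtain ⟨C1, h1, h1'⟩ := h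
  obtain ⟨C2, h2, h2'⟩ := h'
  refine ⟨C1 * C2, by positivity, fun d => ?_⟩
  rw [abs_mul]
  calc _ ≤ (C1 * A d) * (C2 * B d) :=
        mul_le_mul (h1' d) (h2' d) (abs_nonneg _) ((abs_nonneg _).trans (h1' d))
    _ = _ := by ring

lemma Dom.add {D : Type} {f g B : D → ℝ} (h : Dom f B) (h' : Dom g B) :
    Dom (fun d => f d + g d) B := by
  obtain ⟨C1, h1, h1'⟩ := h
  obtain ⟨C2, h2, h2'⟩ := h'
  refine ⟨C1 + C2, by positivity, fun d => ?_⟩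
  rw [add_mul]
  exact (abs_add_le _ _).trans (add_le_add (h1' d) (h2' d))

lemma Dom.mono {D : Type} {f A B : D → ℝ} (h : Dom f A) (h' : ∀ d, A d ≤ B d) : Dom f B := by
  obtain ⟨C1, h1, h1'⟩ := h
  exact ⟨C1, h1, fun d => (h1' d).trans (mul_le_mul_of_nonneg_left (h' d) h1)⟩

lemma Dom.trans {D : Type} {f A B : D → ℝ} (h : Dom f A) (h' : Dom A B) : Dom f B := by
  obtain ⟨C1, h1, h1'⟩ := h
  obtain ⟨C2, h2, h2'⟩ := h'
  refine ⟨C1 * C2, by positivity, fun d => (h1' d).trans ?_⟩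
  rw [mul_assoc]
  exact mul_le_mul_of_nonneg_left ((le_abs_self _).trans (h2' d)) h1

lemma Dom.of_le {D : Type} {f B : D → ℝ} (h : ∀ d, |f d| ≤ B d) : Dom f B :=
  ⟨1, by norm_num, fun d => by simpa using h d⟩

lemma pdAbs_nonneg (f : Spt → ℝ) (p : Spt) : 0 ≤ pdAbs f p :=
  Finset.sum_nonneg (fun _ _ => abs_nonneg _)

lemma le_pdAbs (f : Spt → ℝ) (p : Spt) (μ : Fin 4) : |pderiv μ f p| ≤ pdAbs f p :=
  Finset.single_le_sum (f := fun μ => |pderiv μ f p|) (fun _ _ => abs_nonneg _) (Finset.mem_univ μ)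

lemma le_lsum {X : Type*} (L : List X) (f : X → ℝ) (h : ∀ x ∈ L, 0 ≤ f x) {x : X} (hx : x ∈ L) :
    f x ≤ (L.map f).sum := by
  apply List.single_le_sum
  · intro y hy
    obtain ⟨z, hz, rfl⟩ := List.mem_map.1 hy
    exact h z hz
  · exact List.mem_map_of_mem hx

lemma FQ_term_nonneg {C₀ : ℝ} (d : Dat C₀) (x : List VF × List VF × List VF) :
    0 ≤ (-(uu d.M₀ d.p)) ^ (zeta x.2.2) * pdAbs (Zop x.2.1 d.φ) d.p * pdAbs (Zop x.1 d.φ) d.p := by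
  have := zpow_nonneg d.hu.le (zeta x.2.2)
  have := pdAbs_nonneg (Zop x.2.1 d.φ) d.p
  have := pdAbs_nonneg (Zop x.1 d.φ) d.p
  positivity

lemma le_FQ {C₀ : ℝ} (d : Dat C₀) {l a b c : List VF} (h : (a, b, c) ∈ sp3 l) :
    (-(uu d.M₀ d.p)) ^ (zeta c) * pdAbs (Zop b d.φ) d.p * pdAbs (Zop a d.φ) d.p
      ≤ FQ d.M₀ d.φ l d.p :=
  le_lsum (sp3 l) (fun abc => (-(uu d.M₀ d.p)) ^ (zeta abc.2.2) * pdAbs (Zop abc.2.1 d.φ) d.p *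
    pdAbs (Zop abc.1 d.φ) d.p) (fun x _ => FQ_term_nonneg d x) h

lemma FQ_nonneg {C₀ : ℝ} (d : Dat C₀) (l : List VF) : 0 ≤ FQ d.M₀ d.φ l d.p := by
  apply List.sum_nonneg
  intro y hy
  obtain ⟨z, hz, rfl⟩ := List.mem_map.1 hy
  exact FQ_term_nonneg d z

lemma FC_term_nonneg {C₀ : ℝ} (d : Dat C₀) (x : List VF × List VF × List VF × List VF) :
    0 ≤ if x.1 = [] then 0
    else |Zop x.1 d.φ d.p| * pdAbs (Zop x.2.1 d.φ) d.p * pdAbs (Zop x.2.2.1 d.φ) d.p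
          * (-(uu d.M₀ d.p)) ^ (zeta x.2.2.2) := by
  split_ifs
  · exact le_rfl
  have := zpow_nonneg d.hu.le (zeta x.2.2.2)
  have := pdAbs_nonneg (Zop x.2.1 d.φ) d.p
  have := pdAbs_nonneg (Zop x.2.2.1 d.φ) d.p
  positivity

lemma FC_nonneg {C₀ : ℝ} (d : Dat C₀) (l : List VF) : 0 ≤ FC d.M₀ d.φ l d.p := by
  apply List.sum_nonneg
  intro y hy
  obtain ⟨z, hz, rfl⟩ := List.mem_map.1 hy
  exact FC_term_nonneg d z

lemma le_FC {C₀ : ℝ} (d : Dat C₀) {l a b c e : List VF} (h : (a, b, c, e) ∈ sp4 l) (ha : a ≠ []) :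
    |Zop a d.φ d.p| * pdAbs (Zop b d.φ) d.p * pdAbs (Zop c d.φ) d.p
          * (-(uu d.M₀ d.p)) ^ (zeta e) ≤ FC d.M₀ d.φ l d.p := by
  have := le_lsum (sp4 l) (fun x => if x.1 = [] then 0
    else |Zop x.1 d.φ d.p| * pdAbs (Zop x.2.1 d.φ) d.p * pdAbs (Zop x.2.2.1 d.φ) d.p
          * (-(uu d.M₀ d.p)) ^ (zeta x.2.2.2)) (fun x _ => FC_term_nonneg d x) h
  simpa [ha, FC] using this

/-- part (i), for a fixed product. -/
lemma part1 (C₀ : ℝ) (l : List VF) (α β : Fin 4) :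
    Dom (fun d : Dat C₀ => Zop l (fun x => pderiv α d.φ x * pderiv β d.φ x) d.p)
      (fun d => FQ d.M₀ d.φ l d.p) := by
  have e : (fun d : Dat C₀ => Zop l (fun x => pderiv α d.φ x * pderiv β d.φ x) d.p) =
      fun d => ((sp2 l).map (fun ab =>
        Zop ab.1 (pderiv α d.φ) d.p * Zop ab.2 (pderiv β d.φ) d.p)).sum := by
    funext d
    rw [zop_mul (d.hφ.pd α) (d.hφ.pd β)]
  rw [e]
  apply Dom.lsum (sp2 l) (fun ab (d : Dat C₀) =>
        Zop ab.1 (pderiv α d.φ) d.p * Zop ab.2 (pderiv β d.φ) d.p)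
  rintro ⟨a, b⟩ hab
  obtain ⟨K, hK, hK'⟩ := rep a α
  obtain ⟨J, hJ, hJ'⟩ := rep b β
  have e : (fun d : Dat C₀ => Zop a (pderiv α d.φ) d.p * Zop b (pderiv β d.φ) d.p) =
      fun d => (K.map (fun t => (J.map (fun s => (t.1 * pderiv t.2.1 (Zop t.2.2 d.φ) d.p) *
        (s.1 * pderiv s.2.1 (Zop s.2.2 d.φ) d.p))).sum)).sum := by
    funext d
    rw [hK' _ d.hφ, hJ' _ d.hφ]
    simp only [List.sum_map_mul_left, List.sum_map_mul_right]
  show Dom (fun d : Dat C₀ => Zop a (pderiv α d.φ) d.p * Zop b (pderiv β d.φ) d.p) _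
  rw [e]
  refine Dom.lsum K (fun t (d : Dat C₀) => (J.map (fun s =>
    (t.1 * pderiv t.2.1 (Zop t.2.2 d.φ) d.p) *
        (s.1 * pderiv s.2.1 (Zop s.2.2 d.φ) d.p))).sum) _ ?_
  intro t ht
  refine Dom.lsum J (fun s (d : Dat C₀) =>
    (t.1 * pderiv t.2.1 (Zop t.2.2 d.φ) d.p) *
        (s.1 * pderiv s.2.1 (Zop s.2.2 d.φ) d.p)) _ ?_
  intro s hs
  obtain ⟨c1, h1, z1⟩ := hK t ht
  obtain ⟨c2, h2, z2⟩ := hJ s hs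
  obtain ⟨m, hm, hm'⟩ := sp2_assoc hab h1
  obtain ⟨c, hc, hc'⟩ := sp2_assoc (sp2_swap hm') h2
  have zc : zeta c = 0 := by rw [sp2_zeta hc', z1, z2]; rfl
  refine ⟨|t.1| * |s.1|, by positivity, fun d => ?_⟩
  have := le_FQ d (sp3_mem hm hc)
  rw [zc, zpow_zero, one_mul] at this
  simp only [abs_mul]
  calc _ = (|t.1| * |s.1|) * (|pderiv s.2.1 (Zop s.2.2 d.φ) d.p| *
        |pderiv t.2.1 (Zop t.2.2 d.φ) d.p|) := by ring
    _ ≤ _ := by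
      apply mul_le_mul_of_nonneg_left _ (by positivity)
      refine le_trans ?_ this
      exact mul_le_mul (le_pdAbs _ _ _) (le_pdAbs _ _ _) (abs_nonneg _) (pdAbs_nonneg _ _)

/-- majorant for derivatives of `N(φ)`. -/
def FN (M₀ : ℝ) (φ : Spt → ℝ) (l : List VF) (p : Spt) : ℝ :=
  ((sp2 l).map (fun x => if x.1 = [] then 0 else
    |Zop x.1 φ p| * (-(uu M₀ p)) ^ (zeta x.2))).sum

lemma FN_term_nonneg {C₀ : ℝ} (d : Dat C₀) (x : List VF × List VF) :
    0 ≤ if x.1 = [] then 0 else |Zop x.1 d.φ d.p| * (-(uu d.M₀ d.p)) ^ (zeta x.2) := by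
  split_ifs
  · exact le_rfl
  have := zpow_nonneg d.hu.le (zeta x.2)
  positivity

lemma le_FN {C₀ : ℝ} (d : Dat C₀) {l a b : List VF} (h : (a, b) ∈ sp2 l) (ha : a ≠ []) :
    |Zop a d.φ d.p| * (-(uu d.M₀ d.p)) ^ (zeta b) ≤ FN d.M₀ d.φ l d.p := by
  have := le_lsum (sp2 l) (fun x => if x.1 = [] then 0 else
    |Zop x.1 d.φ d.p| * (-(uu d.M₀ d.p)) ^ (zeta x.2)) (fun x _ => FN_term_nonneg d x) h
  simpa [ha, FN] using this

lemma app_comp {f : Spt → ℝ} (hf : Sm f) {G : ℝ → ℝ} (hG : ContDiff ℝ (⊤ : ℕ∞) G) (Z : VF) :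
    Z.app (fun x => G (f x)) = fun p => deriv G (f p) * Z.app f p := by
  funext p
  simp only [app_eq]
  have h := ((hG.differentiable (by norm_num) (f p)).hasDerivAt).comp_hasFDerivAt p
    (hf.da p).hasFDerivAt
  have h2 : HasFDerivAt (fun x => G (f x)) (deriv G (f p) • fderiv ℝ f p) p := h
  rw [h2.fderiv]
  simp

lemma deriv_smooth {G : ℝ → ℝ} (hG : ContDiff ℝ (⊤ : ℕ∞) G) : ContDiff ℝ (⊤ : ℕ∞) (deriv G) :=
  (contDiff_infty_iff_deriv.1 hG).2

lemma pN (C₀ : ℝ) (l : List VF) (hl : l ≠ []) (hl3 : l.length ≤ 3) (α β : Fin 4) :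
    Dom (fun d : Dat C₀ => Zop l (fun x => d.N α β (d.φ x)) d.p)
      (fun d => FN d.M₀ d.φ l d.p) := by
  have hC : ∀ i ≤ 3, Dom (fun d : Dat C₀ => iteratedDeriv i (d.N α β) (d.φ d.p)) (fun _ => 1) :=
    fun i hi => ⟨|C₀|, abs_nonneg _, fun d => by
      simpa using (d.hb α β i hi).trans (le_abs_self _)⟩
  have hz : ∀ Z : VF, Dom (fun d : Dat C₀ => Z.app d.φ d.p)
    (fun d => (-(uu d.M₀ d.p)) ^ (VF.zeta Z)) := fun Z => Dom.of_le (fun d => d.hZ Z)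
  have hs : ∀ l, Dom (fun d : Dat C₀ => Zop l d.φ d.p) (fun d => |Zop l d.φ d.p|) :=
    fun l => Dom.of_le (fun d => le_rfl)
  have e1 : ∀ (d : Dat C₀) (Z : VF), Z.app (fun x => d.N α β (d.φ x)) =
      fun p => deriv (d.N α β) (d.φ p) * Z.app d.φ p := fun d Z => app_comp d.hφ (d.hN α β) Z
  have e2 : ∀ (d : Dat C₀) (Y Z : VF), Y.app (Z.app (fun x => d.N α β (d.φ x))) =
      fun p => deriv (deriv (d.N α β)) (d.φ p) * Y.app d.φ p * Z.app d.φ p +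
        deriv (d.N α β) (d.φ p) * Y.app (Z.app d.φ) p := by
    intro d Y Z
    have h1 := deriv_smooth (d.hN α β)
    have s1 : Sm (fun p => deriv (d.N α β) (d.φ p)) := ContDiff.comp h1 d.hφ
    funext p
    rw [e1, app_mul s1 (d.hφ.app Z), app_comp d.hφ h1]
  have e3 : ∀ (d : Dat C₀) (X Y Z : VF) (p : Spt),
      X.app (Y.app (Z.app (fun x => d.N α β (d.φ x)))) p =
      deriv (deriv (deriv (d.N α β))) (d.φ p) * X.app d.φ p * Y.app d.φ p * Z.app d.φ p +
      deriv (deriv (d.N α β)) (d.φ p) * X.app (Y.app d.φ) p * Z.app d.φ p +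
      deriv (deriv (d.N α β)) (d.φ p) * Y.app d.φ p * X.app (Z.app d.φ) p +
      deriv (deriv (d.N α β)) (d.φ p) * X.app d.φ p * Y.app (Z.app d.φ) p +
      deriv (d.N α β) (d.φ p) * X.app (Y.app (Z.app d.φ)) p := by
    intro d X Y Z p
    have h1 := deriv_smooth (d.hN α β)
    have h2 := deriv_smooth h1
    have s1 : Sm (fun p => deriv (d.N α β) (d.φ p)) := ContDiff.comp h1 d.hφ
    have s2 : Sm (fun p => deriv (deriv (d.N α β)) (d.φ p)) := ContDiff.comp h2 d.hφ
    have s3 : Sm (fun p => deriv (deriv (d.N α β)) (d.φ p) * Y.app d.φ p) :=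
      ContDiff.mul s2 (d.hφ.app Y)
    rw [e2, app_add (ContDiff.mul s3 (d.hφ.app Z)) (ContDiff.mul s1 ((d.hφ.app Z).app Y)),
      app_mul s3 (d.hφ.app Z), app_mul s2 (d.hφ.app Y), app_mul s1 ((d.hφ.app Z).app Y),
      app_comp d.hφ h1, app_comp d.hφ h2]
    ring
  have hC1 := hC 1 (by norm_num)
  have hC2 := hC 2 (by norm_num)
  have hC3 := hC 3 (by norm_num)
  simp only [iteratedDeriv_succ, iteratedDeriv_zero] at hC1 hC2 hC3
  have zp : ∀ (d : Dat C₀) (m n : ℤ), (-(uu d.M₀ d.p)) ^ (m + n) =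
    (-(uu d.M₀ d.p)) ^ m * (-(uu d.M₀ d.p)) ^ n := fun d m n => zpow_add₀ d.hu.ne' m n
  match l, hl, hl3 with
  | [Z], _, _ =>
    simp only [Zop, e1]
    refine (hC1.mul (hs [Z])).mono (fun d => ?_)
    refine le_trans (le_of_eq ?_) (le_FN d (a := [Z]) (b := []) (by simp [sp2]) (by simp))
    simp [zeta]
  | [Y, Z], _, _ =>
    simp only [Zop, e2]
    refine Dom.add (((hC2.mul (hs [Y])).mul (hz Z)).mono (fun d => ?_))
      ((hC1.mul (hs [Y, Z])).mono (fun d => ?_))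
    · refine le_trans (le_of_eq ?_) (le_FN d (a := [Y]) (b := [Z]) (by simp [sp2]) (by simp))
      simp [zeta]
    · refine le_trans (le_of_eq ?_) (le_FN d (a := [Y, Z]) (b := []) (by simp [sp2]) (by simp))
      simp [zeta]
  | [X, Y, Z], _, _ =>
    simp only [Zop, e3]
    refine Dom.add (Dom.add (Dom.add (Dom.add
      ((((hC3.mul (hs [X])).mul (hz Y)).mul (hz Z)).mono (fun d => ?_))
      (((hC2.mul (hs [X, Y])).mul (hz Z)).mono (fun d => ?_)))
      (((hC2.mul (hz Y)).mul (hs [X, Z])).mono (fun d => ?_)))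
      (((hC2.mul (hz X)).mul (hs [Y, Z])).mono (fun d => ?_)))
      ((hC1.mul (hs [X, Y, Z])).mono (fun d => ?_))
    · refine le_trans (le_of_eq ?_) (le_FN d (a := [X]) (b := [Y, Z]) (by simp [sp2]) (by simp))
      simp [zeta, zp, mul_assoc]
    · refine le_trans (le_of_eq ?_) (le_FN d (a := [X, Y]) (b := [Z]) (by simp [sp2]) (by simp))
      simp [zeta]
    · refine le_trans (le_of_eq ?_) (le_FN d (a := [X, Z]) (b := [Y]) (by simp [sp2]) (by simp))
      simp [zeta, mul_comm]
    · refine le_trans (le_of_eq ?_) (le_FN d (a := [Y, Z]) (b := [X]) (by simp [sp2]) (by simp))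
      simp [zeta, mul_comm]
    · refine le_trans (le_of_eq ?_) (le_FN d (a := [X, Y, Z]) (b := []) (by simp [sp2]) (by simp))
      simp [zeta]

lemma FN_FQ (C₀ : ℝ) {l a b : List VF} (hab : (a, b) ∈ sp2 l) :
    Dom (fun d : Dat C₀ => FN d.M₀ d.φ a d.p * FQ d.M₀ d.φ b d.p)
      (fun d => FC d.M₀ d.φ l d.p) := by
  simp only [FN, FQ, ← List.sum_map_mul_right]
  refine Dom.lsum (sp2 a) (fun x (d : Dat C₀) => (if x.1 = [] then 0 else
    |Zop x.1 d.φ d.p| * (-(uu d.M₀ d.p)) ^ (zeta x.2)) * ((sp3 b).map (fun abc =>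
    (-(uu d.M₀ d.p)) ^ (zeta abc.2.2) * pdAbs (Zop abc.2.1 d.φ) d.p *
      pdAbs (Zop abc.1 d.φ) d.p)).sum) _ ?_
  rintro ⟨a1, a2⟩ h1
  by_cases ha : a1 = []
  · refine Dom.of_le (fun d => ?_)
    simpa [ha] using FC_nonneg d l
  simp only [← List.sum_map_mul_left]
  refine Dom.lsum (sp3 b) (fun abc (d : Dat C₀) => (if a1 = [] then 0 else
    |Zop a1 d.φ d.p| * (-(uu d.M₀ d.p)) ^ (zeta a2)) *
    ((-(uu d.M₀ d.p)) ^ (zeta abc.2.2) * pdAbs (Zop abc.2.1 d.φ) d.p *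
      pdAbs (Zop abc.1 d.φ) d.p)) _ ?_
  rintro ⟨b1, b2, b3⟩ hb
  obtain ⟨q, hq, hq'⟩ := mem_sp3 hb
  obtain ⟨m, m1, m2⟩ := sp2_assoc hab h1
  obtain ⟨m', m3, m4⟩ := sp2_assoc (sp2_swap m2) hq
  obtain ⟨m'', m5, m6⟩ := sp2_assoc m4 hq'
  refine Dom.of_le (fun d => ?_)
  rw [abs_of_nonneg (mul_nonneg (FN_term_nonneg d (a1, a2)) (FQ_term_nonneg d (b1, b2, b3)))]
  refine le_trans (le_of_eq ?_) (le_FC d (sp4_mem m1 m3 m5) ha)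
  rw [sp2_zeta m6, zpow_add₀ d.hu.ne']
  simp only [ha, if_false]
  ring

lemma part2 (C₀ : ℝ) (l : List VF) (hl : l.length ≤ 3) :
    Dom (fun d : Dat C₀ => Zop l (fun x => ∑ α, ∑ β, d.N α β (d.φ x) * pderiv α d.φ x *
      pderiv β d.φ x) d.p)
      (fun d => FQ d.M₀ d.φ l d.p + FC d.M₀ d.φ l d.p) := by
  let L : List (Fin 4 × Fin 4) := (Finset.univ : Finset (Fin 4 × Fin 4)).toList
  have sN : ∀ (d : Dat C₀) α β, Sm (fun x => d.N α β (d.φ x)) :=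
    fun d α β => ContDiff.comp (d.hN α β) d.hφ
  have sP : ∀ (d : Dat C₀) α β, Sm (fun x => pderiv α d.φ x * pderiv β d.φ x) :=
    fun d α β => ContDiff.mul (d.hφ.pd α) (d.hφ.pd β)
  have e : (fun d : Dat C₀ => Zop l (fun x => ∑ α, ∑ β, d.N α β (d.φ x) * pderiv α d.φ x *
      pderiv β d.φ x) d.p) = fun d => (L.map (fun ab => ((sp2 l).map (fun xy =>
        Zop xy.1 (fun x => d.N ab.1 ab.2 (d.φ x)) d.p *
        Zop xy.2 (fun x => pderiv ab.1 d.φ x * pderiv ab.2 d.φ x) d.p)).sum)).sum := by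
    funext d
    have e0 : (fun x => ∑ α, ∑ β, d.N α β (d.φ x) * pderiv α d.φ x * pderiv β d.φ x) =
      fun x => (L.map (fun ab => d.N ab.1 ab.2 (d.φ x) *
        (pderiv ab.1 d.φ x * pderiv ab.2 d.φ x))).sum := by
      funext x
      rw [Finset.sum_map_toList, Fintype.sum_prod_type]
      simp only [mul_assoc]
    rw [e0, zop_lsum L (fun ab x => d.N ab.1 ab.2 (d.φ x) *
        (pderiv ab.1 d.φ x * pderiv ab.2 d.φ x))
        (fun ab _ => ContDiff.mul (sN d _ _) (sP d _ _))]
    simp only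
    congr 1
    apply List.map_congr_left
    intro ab _
    rw [zop_mul (sN d ab.1 ab.2) (sP d ab.1 ab.2)]
  rw [e]
  refine Dom.lsum L (fun ab (d : Dat C₀) => ((sp2 l).map (fun xy =>
        Zop xy.1 (fun x => d.N ab.1 ab.2 (d.φ x)) d.p *
        Zop xy.2 (fun x => pderiv ab.1 d.φ x * pderiv ab.2 d.φ x) d.p)).sum) _ ?_
  rintro ⟨α, β⟩ _
  refine Dom.lsum (sp2 l) (fun xy (d : Dat C₀) =>
        Zop xy.1 (fun x => d.N α β (d.φ x)) d.p *
        Zop xy.2 (fun x => pderiv α d.φ x * pderiv β d.φ x) d.p) _ ?_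
  rintro ⟨a, b⟩ hab
  by_cases ha : a = []
  · subst ha
    obtain rfl := sp2_nil_eq hab
    have h0 : Dom (fun d : Dat C₀ => Zop [] (fun x => d.N α β (d.φ x)) d.p) (fun _ => 1) :=
      ⟨|C₀|, abs_nonneg _, fun d => by
        simpa [Zop] using (d.hb α β 0 (by norm_num)).trans (le_abs_self _)⟩
    refine (h0.mul (part1 C₀ b α β)).mono (fun d => ?_)
    rw [one_mul]
    exact le_add_of_nonneg_right (FC_nonneg d b)
  · have hlen := sp2_len hab
    refine (((pN C₀ a ha (by omega) α β).mul (part1 C₀ b α β)).trans (FN_FQ C₀ hab)).mono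
      (fun d => ?_)
    exact le_add_of_nonneg_left (FQ_nonneg d l)

instance : Finite VF := by
  let f : (Fin 3 × Fin 3) ⊕ Fin 4 → VF := Sum.elim (fun x => .rot x.1 x.2) .pd
  refine Finite.of_surjective f ?_
  rintro (⟨i, j⟩ | μ)
  · exact ⟨.inl (i, j), rfl⟩
  · exact ⟨.inr μ, rfl⟩

lemma uniform {ι : Type} {D : Type} (S : Set ι) (hS : S.Finite) (f B : ι → D → ℝ)
    (hB : ∀ i d, 0 ≤ B i d) (h : ∀ i ∈ S, Dom (f i) (B i)) :
    ∃ C : ℝ, 0 ≤ C ∧ ∀ i ∈ S, ∀ d, |f i d| ≤ C * B i d := by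
  choose! c hc hc' using h
  refine ⟨∑ i ∈ hS.toFinset, c i, Finset.sum_nonneg (fun i hi => hc i (by simpa using hi)), ?_⟩
  intro i hi d
  refine (hc' i hi d).trans (mul_le_mul_of_nonneg_right ?_ (hB i d))
  exact Finset.single_le_sum (f := c) (fun i hi => hc i (by simpa using hi)) (by simpa using hi)

lemma u_pos {M₀ R : ℝ} {p : Spt} (hM : |M₀| < 1 / 100) (hR : 2 ≤ R) (hp : uu M₀ p ≤ u0 M₀ R) :
    0 < -(uu M₀ p) := by
  obtain ⟨h1, h2⟩ := abs_lt.1 hM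
  have hpos : 0 < 1 + M₀ := by linarith
  have hge : 1 ≤ (R + M₀) / (1 + M₀) := by
    rw [le_div_iff₀ hpos]; linarith
  have hlog := Real.log_nonneg hge
  have hlog2 := Real.log_le_sub_one_of_pos (lt_of_lt_of_le one_pos hge)
  have h3 : (R + M₀) / (1 + M₀) ≤ 2 * R := by
    rw [div_le_iff₀ hpos]; nlinarith
  unfold u0 rstar at hp
  nlinarith

/-- structure of derivatives of the nonlinearity
`F = N^{αβ}(φ)∂_αφ∂_βφ` (Lemma 6.3.5.18 of the paper). -/
theorem nonlinearity_structure (C₀ : ℝ) :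
    ∃ C : ℝ, 0 < C ∧
    ∀ (N : Fin 4 → Fin 4 → ℝ → ℝ) (φ : Spt → ℝ) (U : Set Spt) (M₀ R δ : ℝ),
      ContDiff ℝ (⊤ : ℕ∞) φ → (∀ α β, ContDiff ℝ (⊤ : ℕ∞) (N α β)) →
      |M₀| < 1 / 100 → 2 ≤ R → U ⊆ {p : Spt | uu M₀ p ≤ u0 M₀ R} →
      0 < δ → δ ≤ 1 →
      (∀ Z : VF, ∀ p ∈ U, |Z.app φ p| ≤ Real.sqrt δ * (-(uu M₀ p)) ^ (VF.zeta Z)) →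
      (∀ α β, ∀ i : ℕ, i ≤ 3 → ∀ p ∈ U, |iteratedDeriv i (N α β) (φ p)| ≤ C₀) →
      ∀ Zl : List VF, Zl.length ≤ 3 → ∀ p ∈ U,
        -- (i)
        (∀ α β : Fin 4,
          |Zop Zl (fun x => pderiv α φ x * pderiv β φ x) p| ≤ C * FQ M₀ φ Zl p) ∧
        -- (ii)
        |Zop Zl (fun x => ∑ α, ∑ β, N α β (φ x) * pderiv α φ x * pderiv β φ x) p|
          ≤ C * (FQ M₀ φ Zl p + FC M₀ φ Zl p) := by
  have hfin : {l : List VF | l.length ≤ 3}.Finite := List.finite_length_le VF 3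
  obtain ⟨C1, hC1, h1⟩ := uniform (ι := List VF × Fin 4 × Fin 4) (D := Dat C₀)
    ({l : List VF | l.length ≤ 3} ×ˢ Set.univ) (hfin.prod Set.finite_univ)
    (fun i d => Zop i.1 (fun x => pderiv i.2.1 d.φ x * pderiv i.2.2 d.φ x) d.p)
    (fun i d => FQ d.M₀ d.φ i.1 d.p) (fun i d => FQ_nonneg d i.1)
    (fun i _ => part1 C₀ i.1 i.2.1 i.2.2)
  obtain ⟨C2, hC2, h2⟩ := uniform (D := Dat C₀) {l : List VF | l.length ≤ 3} hfin
    (fun l d => Zop l (fun x => ∑ α, ∑ β, d.N α β (d.φ x) * pderiv α d.φ x *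
      pderiv β d.φ x) d.p)
    (fun l d => FQ d.M₀ d.φ l d.p + FC d.M₀ d.φ l d.p)
    (fun l d => add_nonneg (FQ_nonneg d l) (FC_nonneg d l))
    (fun l hl => part2 C₀ l hl)
  refine ⟨C1 + C2 + 1, by positivity, ?_⟩
  intro N φ U M₀ R δ hφ hN hM hR hU hδ hδ1 hZ hb Zl hZl p hp
  have hu := u_pos hM hR (hU hp)
  let d : Dat C₀ :=
    { N := N, φ := φ, M₀ := M₀, p := p, hφ := hφ, hN := hN, hu := hu
      hZ := fun Z => (hZ Z p hp).trans
        (mul_le_of_le_one_left (zpow_nonneg hu.le _) (Real.sqrt_le_one.2 hδ1))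
      hb := fun α β i hi => hb α β i hi p hp }
  have n1 := FQ_nonneg d Zl
  have n2 := FC_nonneg d Zl
  constructor
  · intro α β
    refine (h1 (Zl, α, β) ⟨hZl, Set.mem_univ _⟩ d).trans
      (mul_le_mul_of_nonneg_right (by linarith) n1)
  · refine (h2 Zl hZl d).trans
      (mul_le_mul_of_nonneg_right (by linarith) (add_nonneg n1 n2))

end ExtStab
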